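/- The sequence {(x^k, w^k)} generated by Algorithm iPALM is bounded. -/

import Mathlib

open scoped RealInnerProductSpace
open Filter Topology ContinuousLinearMap

/-- The set of subgradients (in the sense of convex analysis) of an
extended-real-valued function on a real inner product space. -/
def ESubdiff {W : Type*} [NormedAddCommGroup W] [InnerProductSpace ℝ W]
    (φ : W → EReal) (w : W) : Set W :=
  {d | ∀ u : W, φ w + ((⟪d, u - w⟫ : ℝ) : EReal) ≤ φ u}

/-- Convexity of an extended-real-valued function. -/
def EConvex {W : Type*} [AddCommGroup W] [Module ℝ W] (φ : W → EReal) : Prop :=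
  ∀ u v : W, ∀ a b : ℝ, 0 ≤ a → 0 ≤ b → a + b = 1 →
    φ (a • u + b • v) ≤ (a : EReal) * φ u + (b : EReal) * φ v

/-- A continuous function on a finite-dimensional space that is homogeneous of degree two and
positive away from the origin dominates a positive multiple of the squared norm. -/
lemma exists_pos_mul_sq_norm_le {W : Type*} [NormedAddCommGroup W] [NormedSpace ℝ W]
    [FiniteDimensional ℝ W] {f : W → ℝ} (hf : Continuous f)
    (hom : ∀ (t : ℝ) (v : W), f (t • v) = t ^ 2 * f v) (hpos : ∀ v, v ≠ 0 → 0 < f v) :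
    ∃ m : ℝ, 0 < m ∧ ∀ v, m * ‖v‖ ^ 2 ≤ f v := by
  have h0 : f 0 = 0 := by simpa using hom 0 0
  rcases (Metric.sphere (0 : W) 1).eq_empty_or_nonempty with he | hne
  · refine ⟨1, one_pos, fun v => ?_⟩
    rcases eq_or_ne v 0 with rfl | hv
    · simp [h0]
    · have : (‖v‖⁻¹ • v) ∈ Metric.sphere (0 : W) 1 := by
        simp [norm_smul, inv_mul_cancel₀ (norm_ne_zero_iff.2 hv)]
      simp [he] at this
  · obtain ⟨z, hz, hmin⟩ := (isCompact_sphere (0 : W) 1).exists_isMinOn hne hf.continuousOn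
    have hz0 : z ≠ 0 := by
      rintro rfl
      simp at hz
    refine ⟨f z, hpos z hz0, fun v => ?_⟩
    rcases eq_or_ne v 0 with rfl | hv
    · simp [h0]
    · have hv' := norm_ne_zero_iff.2 hv
      have hmem : (‖v‖⁻¹ • v) ∈ Metric.sphere (0 : W) 1 := by
        simp [norm_smul, inv_mul_cancel₀ hv']
      have hle : f z ≤ f (‖v‖⁻¹ • v) := hmin hmem
      calc f z * ‖v‖ ^ 2 ≤ f (‖v‖⁻¹ • v) * ‖v‖ ^ 2 := by gcongr
        _ = f v := by rw [hom]; field_simp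

/-- If `0 ≤ a + t * b` for all `t ∈ (0, 1]`, then `0 ≤ a`. -/
lemma nonneg_of_forall_add_mul_nonneg {a b : ℝ}
    (hab : ∀ t : ℝ, 0 < t → t ≤ 1 → 0 ≤ a + t * b) : 0 ≤ a := by
  have hlim : Tendsto (fun t : ℝ => a + t * b) (𝓝[>] 0) (𝓝 a) := by
    have : ContinuousWithinAt (fun t : ℝ => a + t * b) (Set.Ioi 0) 0 := by fun_prop
    simpa [ContinuousWithinAt] using this
  refine ge_of_tendsto hlim ?_
  filter_upwards [Ioc_mem_nhdsGT (zero_lt_one : (0 : ℝ) < 1)] with t ht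
  exact hab t ht.1 ht.2

/-- The first-order characterization of convexity. -/
lemma ConvexOn.add_inner_gradient_le {W : Type*} [NormedAddCommGroup W] [InnerProductSpace ℝ W]
    [CompleteSpace W] {h : W → ℝ} (hh : ConvexOn ℝ Set.univ h) {v : W}
    (hd : DifferentiableAt ℝ h v) (u : W) :
    h v + ⟪gradient h v, u - v⟫ ≤ h u := by
  have hline : HasDerivAt (fun t : ℝ => h (AffineMap.lineMap v u t)) ⟪gradient h v, u - v⟫ 0 := by
    have h1 : HasDerivAt (fun t : ℝ => AffineMap.lineMap v u t) (u - v) 0 :=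
      AffineMap.hasDerivAt_lineMap
    have h2 : HasFDerivAt h (InnerProductSpace.toDual ℝ W (gradient h v))
        (AffineMap.lineMap v u (0 : ℝ)) := by
      simpa using hd.hasGradientAt.hasFDerivAt
    exact h2.comp_hasDerivAt (0 : ℝ) h1
  have hconv : ConvexOn ℝ Set.univ (fun t : ℝ => h (AffineMap.lineMap v u t)) := by
    exact hh.comp_affineMap (AffineMap.lineMap v u)
  have := hconv.le_slope_of_hasDerivAt (Set.mem_univ 0) (Set.mem_univ 1) one_pos hline
  simp only [slope_def_field, AffineMap.lineMap_apply_one, AffineMap.lineMap_apply_zero, sub_zero,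
    div_one] at this
  linarith

/-- A three-point form of cocoercivity of the gradient of a convex function that is majorized
by a quadratic. -/
lemma ConvexOn.inner_gradient_sub_ge {W : Type*} [NormedAddCommGroup W] [InnerProductSpace ℝ W]
    [CompleteSpace W] {h : W → ℝ} (hh : ConvexOn ℝ Set.univ h) (hd : Differentiable ℝ h)
    {Sig : W →L[ℝ] W}
    (hmaj : ∀ u v : W, h u ≤ h v + ⟪gradient h v, u - v⟫ + (1 / 2) * ⟪Sig (u - v), u - v⟫)
    (v y z : W) :
    -(1 / 4) * ⟪Sig (z - v), z - v⟫ ≤ ⟪gradient h v - gradient h y, z - y⟫ := by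
  set s := (1 / 2 : ℝ) • (z - v) with hs
  have hz : z - v = (2 : ℝ) • s := by simp [hs]
  have hzy : z - y = (v - y) + (2 : ℝ) • s := by rw [← hz]; abel
  have e1 := hmaj (v + s) v
  have e2 := hmaj (y - s) y
  have e3 := hh.add_inner_gradient_le (hd v) (y - s)
  have e4 := hh.add_inner_gradient_le (hd y) (v + s)
  rw [hz, hzy]
  simp only [add_sub_cancel_left, sub_sub_cancel_left, map_neg, map_smul,
    inner_add_right, inner_sub_left, inner_sub_right, inner_neg_left,
    inner_neg_right, real_inner_smul_left, real_inner_smul_right] at *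
  linarith

/-- A minimizer of the sum of a convex extended-real-valued function and a function with a
quadratic expansion along a segment satisfies the first-order condition along that segment. -/
lemma EConvex.toReal_add_le_of_quadratic {W : Type*} [NormedAddCommGroup W]
    [InnerProductSpace ℝ W] {φ : W → EReal} (hφ : EConvex φ) (hbot : ∀ v, φ v ≠ ⊥)
    {q : W → ℝ} {g p u : W} (hg : g ∈ ESubdiff (fun v => φ v + (q v : EReal)) p)
    (hp : φ p ≠ ⊤) (hu : φ u ≠ ⊤) {l r : ℝ}
    (hq : ∀ t : ℝ, q ((1 - t) • p + t • u) = q p + t * l + t ^ 2 * r) :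
    (φ p).toReal + ⟪g, u - p⟫ ≤ (φ u).toReal + l := by
  suffices 0 ≤ (φ u).toReal + l - (φ p).toReal - ⟪g, u - p⟫ by linarith
  refine nonneg_of_forall_add_mul_nonneg (b := r) fun t ht0 ht1 => ?_
  have e1 := hg ((1 - t) • p + t • u)
  have e2 := hφ p u (1 - t) t (by linarith) ht0.le (by ring)
  have e3 : ((1 - t) • p + t • u) - p = t • (u - p) := by module
  have e4 := e1.trans (add_le_add e2 le_rfl)
  beta_reduce at e4
  rw [e3, hq, ← EReal.coe_toReal hp (hbot p), ← EReal.coe_toReal hu (hbot u)] at e4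
  norm_cast at e4
  rw [real_inner_smul_right] at e4
  refine nonneg_of_mul_nonneg_right (a := t) ?_ ht0
  linear_combination e4

/-- A subgradient of a proper function shifted by a finite one exists only at points of the
effective domain. -/
lemma ne_top_of_mem_ESubdiff_add_coe {W : Type*} [NormedAddCommGroup W]
    [InnerProductSpace ℝ W] {φ : W → EReal} {q : W → ℝ} {g p : W}
    (hg : g ∈ ESubdiff (fun v => φ v + (q v : EReal)) p) (hφtop : ∃ v, φ v ≠ ⊤) :
    φ p ≠ ⊤ := by
  obtain ⟨v, hv⟩ := hφtop
  intro hp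
  have := hg v
  simp only [hp, EReal.top_add_coe, top_le_iff] at this
  exact (EReal.add_lt_top hv (EReal.coe_ne_top _)).ne this

/-- The quasi-Fejér inequality `F (k + 1) ≤ F k + a k * √(F (k + 1))` with summable `a` forces a
nonnegative sequence to be bounded. -/
lemma exists_sqrt_le_of_le_add_mul_sqrt {F a : ℕ → ℝ} (hF : ∀ k, 0 ≤ F k) (ha : ∀ k, 0 ≤ a k)
    (hsum : Summable a) (hrec : ∀ k, F (k + 1) ≤ F k + a k * √(F (k + 1))) :
    ∃ C : ℝ, ∀ k, √(F k) ≤ C := by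
  have hstep : ∀ k, √(F (k + 1)) ≤ √(F k) + a k := by
    intro k
    by_contra! hlt
    have h1 := Real.sq_sqrt (hF k)
    have h2 := Real.sq_sqrt (hF (k + 1))
    have h3 := Real.sqrt_nonneg (F k)
    nlinarith [hrec k, ha k]
  have hpart : ∀ k, √(F k) ≤ √(F 0) + ∑ i ∈ Finset.range k, a i := by
    intro k
    induction k with
    | zero => simp
    | succ k ih => rw [Finset.sum_range_succ]; linarith [hstep k]
  exact ⟨√(F 0) + ∑' i, a i, fun k =>
    (hpart k).trans (by gcongr; exact hsum.sum_le_tsum _ fun i _ => ha i)⟩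

/-- The sequence `{(x^k, w^k)}` generated by Algorithm iPALM is
bounded. -/
theorem stmt_5
    {X W : Type*} [NormedAddCommGroup X] [InnerProductSpace ℝ X] [FiniteDimensional ℝ X]
    [NormedAddCommGroup W] [InnerProductSpace ℝ W] [FiniteDimensional ℝ W]
    -- `φ` is a closed proper convex function on `W`
    (φ : W → EReal) (hφconv : EConvex φ) (hφlsc : LowerSemicontinuous φ)
    (hφbot : ∀ v, φ v ≠ ⊥) (hφtop : ∃ v, φ v ≠ ⊤)
    -- `h` is a convex continuously differentiable function on `W`
    (h : W → ℝ) (hhconv : ConvexOn ℝ Set.univ h) (hhdiff : ContDiff ℝ 1 h)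
    -- problem data, penalty parameter and step-length
    (A : X →L[ℝ] W) (c : X) (σ τ : ℝ) (hσ : 0 < σ) (hτ0 : 0 < τ) (hτ2 : τ < 2)
    -- the majorization operator `Σ_h` (here `Sig`), self-adjoint positive semidefinite
    (Sig S : W →L[ℝ] W) (hSigsa : IsSelfAdjoint Sig) (hSigpsd : ∀ v : W, 0 ≤ ⟪Sig v, v⟫)
    (hmaj : ∀ u v : W, h u ≤ h v + ⟪gradient h v, u - v⟫
      + (1 / 2) * ⟪Sig (u - v), u - v⟫)
    -- the proximal operator `S`: self-adjoint, `S ⪰ -(1/2)Σ_h`,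
    -- and `(1/2)Σ_h + σAA* + S ≻ 0`
    (hSsa : IsSelfAdjoint S)
    (hS1 : ∀ v : W, -(1 / 2) * ⟪Sig v, v⟫ ≤ ⟪S v, v⟫)
    (hS2 : ∀ v : W, v ≠ 0 →
      0 < (1 / 2) * ⟪Sig v, v⟫ + σ * ‖A.adjoint v‖ ^ 2 + ⟪S v, v⟫)
    -- the KKT system has a solution
    (hKKT : ∃ (xs : X) (ws : W),
      -(gradient h ws) - A xs ∈ ESubdiff φ ws ∧ A.adjoint ws = c)
    -- the iPALM iterates: errors, primal and dual sequences
    (ε : ℕ → ℝ) (hε : ∀ k, 0 ≤ ε k) (hεsum : Summable ε)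
    (x : ℕ → X) (w : ℕ → W) (d : ℕ → W)
    (hd : ∀ k, ‖d k‖ ≤ ε k)
    -- `d^k ∈ ∂_w L_σ(w^{k+1}; (x^k, w^k)) + S(w^{k+1} - w^k)`
    (hsub : ∀ k : ℕ, d k - S (w (k + 1) - w k) ∈
      ESubdiff (fun v : W =>
        φ v + ((h (w k) + ⟪gradient h (w k), v - w k⟫
          + (1 / 2) * ⟪Sig (v - w k), v - w k⟫
          + ⟪A.adjoint v - c, x k⟫
          + (σ / 2) * ‖A.adjoint v - c‖ ^ 2 : ℝ) : EReal)) (w (k + 1)))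
    -- `x^{k+1} = x^k + τσ(A* w^{k+1} - c)`
    (hx : ∀ k : ℕ, x (k + 1) = x k + (τ * σ) • (A.adjoint (w (k + 1)) - c))
    :
    ∃ C : ℝ, ∀ k : ℕ, ‖x k‖ ≤ C ∧ ‖w k‖ ≤ C := by
  obtain ⟨xs, ws, hKs, hAs⟩ := hKKT
  have hSig : ∀ u v : W, ⟪Sig u, v⟫ = ⟪Sig v, u⟫ := fun u v => by
    rw [real_inner_comm]; exact (hSigsa.isSymmetric v u).symm
  have hS : ∀ u v : W, ⟪S u, v⟫ = ⟪S v, u⟫ := fun u v => by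
    rw [real_inner_comm]; exact (hSsa.isSymmetric v u).symm
  have hdiff : Differentiable ℝ h := hhdiff.differentiable (by norm_num)
  set G : W → ℝ := fun v => ⟪Sig v, v⟫ + ⟪S v, v⟫ + (2 - τ) * σ * ‖A.adjoint v‖ ^ 2 with hG
  have hGpos : ∀ v, v ≠ 0 → 0 < G v := by
    intro v hv
    have h1 := hS1 v
    have h2 := hS2 v hv
    have h3 := hSigpsd v
    have h4 : 0 < (2 - τ) * σ := mul_pos (by linarith) hσ
    simp only [hG]
    rcases eq_or_ne (A.adjoint v) 0 with h0 | h0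
    · simp only [h0, norm_zero] at h2 ⊢
      linarith
    · have : 0 < (2 - τ) * σ * ‖A.adjoint v‖ ^ 2 := by positivity
      linarith
  obtain ⟨m, hm, hmG⟩ := exists_pos_mul_sq_norm_le (f := G)
    (by simp only [hG]; fun_prop)
    (fun t v => by
      simp only [hG, map_smul, real_inner_smul_left, real_inner_smul_right, norm_smul, mul_pow,
        Real.norm_eq_abs, sq_abs]
      ring) hGpos
  have hτσ : 0 < τ * σ := mul_pos hτ0 hσ
  set F : ℕ → ℝ := fun k => ‖x k - xs‖ ^ 2 / (τ * σ) + G (w k - ws) with hF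
  have hGnn : ∀ v, 0 ≤ G v := fun v => le_trans (by positivity) (hmG v)
  have hFnn : ∀ k, 0 ≤ F k := fun k => add_nonneg (by positivity) (hGnn _)
  have hwF : ∀ k, ‖w k - ws‖ ≤ √m⁻¹ * √(F k) := by
    intro k
    rw [← Real.sqrt_mul (by positivity)]
    refine Real.le_sqrt_of_sq_le ?_
    have h1 := hmG (w k - ws)
    have h2 : m * ‖w k - ws‖ ^ 2 ≤ F k := h1.trans (le_add_of_nonneg_left (by positivity))
    rw [inv_mul_eq_div, le_div_iff₀ hm]
    linarith
  have hxF : ∀ k, ‖x k - xs‖ ≤ √(τ * σ) * √(F k) := by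
    intro k
    rw [← Real.sqrt_mul (by positivity)]
    refine Real.le_sqrt_of_sq_le ?_
    have h2 : ‖x k - xs‖ ^ 2 / (τ * σ) ≤ F k := le_add_of_nonneg_right (hGnn _)
    rw [div_le_iff₀ hτσ] at h2
    linarith
  have hwstop : φ ws ≠ ⊤ := by
    refine ne_top_of_mem_ESubdiff_add_coe (q := 0) (g := -(gradient h ws) - A xs) ?_ hφtop
    simpa using hKs
  have hrec : ∀ k, F (k + 1) ≤ F k + 2 * ε k * √m⁻¹ * √(F (k + 1)) := by
    intro k
    have hsubk := hsub k
    have hptop := ne_top_of_mem_ESubdiff_add_coe hsubk hφtop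
    set p := w (k + 1) with hp
    have hAp : A.adjoint p - c = A.adjoint (p - ws) := by rw [map_sub, hAs]
    have hopt := hφconv.toReal_add_le_of_quadratic hφbot hsubk hptop hwstop
      (l := ⟪gradient h (w k), ws - p⟫ + ⟪Sig (p - w k), ws - p⟫ - ⟪A.adjoint (p - ws), x k⟫
        - σ * ‖A.adjoint (p - ws)‖ ^ 2)
      (r := (1 / 2) * ⟪Sig (ws - p), ws - p⟫ + (σ / 2) * ‖A.adjoint (p - ws)‖ ^ 2) (by
        intro t
        have e1 : (1 - t) • p + t • ws - w k = (p - w k) + t • (ws - p) := by module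
        have e2 : A.adjoint ((1 - t) • p + t • ws) - c = (1 - t) • A.adjoint (p - ws) := by
          rw [← hAs, ← map_sub, ← map_smul]; congr 1; module
        have e3 := hSig (ws - p) (p - w k)
        rw [e1, e2, hAp]
        simp only [map_add, map_smul, inner_add_left, inner_add_right, real_inner_smul_left,
          real_inner_smul_right, norm_smul, mul_pow, Real.norm_eq_abs, sq_abs, e3]
        ring)
    have hsol : (φ ws).toReal + ⟪-(gradient h ws) - A xs, p - ws⟫ ≤ (φ p).toReal := by
      have := hKs p
      rw [← EReal.coe_toReal hptop (hφbot p), ← EReal.coe_toReal hwstop (hφbot ws)] at this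
      exact_mod_cast this
    have hcoc := hhconv.inner_gradient_sub_ge hdiff hmaj (w k) ws p
    have hSv := hS1 (p - w k)
    have hxk : ‖x (k + 1) - xs‖ ^ 2 / (τ * σ) = ‖x k - xs‖ ^ 2 / (τ * σ)
        + 2 * ⟪A.adjoint (p - ws), x k - xs⟫ + τ * σ * ‖A.adjoint (p - ws)‖ ^ 2 := by
      have e1 : x (k + 1) - xs = (x k - xs) + (τ * σ) • A.adjoint (p - ws) := by
        rw [hx k, hAp]; abel
      rw [e1, norm_add_sq_real, real_inner_smul_right, norm_smul, mul_pow, Real.norm_eq_abs,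
        sq_abs, real_inner_comm]
      field_simp
    have hderr : ⟪d k, p - ws⟫ ≤ ε k * (√m⁻¹ * √(F (k + 1))) :=
      (real_inner_le_norm _ _).trans
        (mul_le_mul (hd k) (hwF (k + 1)) (norm_nonneg _) (hε k))
    have hAxs : ⟪A xs, p - ws⟫ = ⟪A.adjoint (p - ws), xs⟫ := by
      rw [adjoint_inner_left, real_inner_comm]
    have hprev : 0 ≤ (2 - τ) * σ * ‖A.adjoint (w k - ws)‖ ^ 2 := by
      have : 0 ≤ 2 - τ := by linarith
      positivity
    obtain ⟨y, hy⟩ : ∃ y, y = p - ws := ⟨_, rfl⟩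
    obtain ⟨v, hv⟩ : ∃ v, v = p - w k := ⟨_, rfl⟩
    have hy' : ws - p = -y := by rw [hy]; abel
    have hwk : w k - ws = y - v := by rw [hy, hv]; abel
    have e5 := hSig v y
    have e6 := hS v y
    generalize √(F (k + 1)) = R at hderr ⊢
    simp only [hF, ← hp, hG]
    rw [hxk]
    rw [hwk] at hprev ⊢
    rw [hy', ← hy, ← hv] at hopt
    rw [← hy] at hsol hderr hAxs ⊢
    rw [← hy, ← hv] at hcoc
    rw [← hv] at hSv
    simp only [map_sub, inner_sub_left, inner_sub_right, inner_neg_left, inner_neg_right]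
      at hopt hsol hcoc hAxs hprev ⊢
    linarith
  obtain ⟨C, hC⟩ := exists_sqrt_le_of_le_add_mul_sqrt hFnn
    (fun k => mul_nonneg (mul_nonneg zero_le_two (hε k)) (Real.sqrt_nonneg _))
    ((hεsum.mul_left 2).mul_right _) hrec
  refine ⟨max (‖xs‖ + √(τ * σ) * C) (‖ws‖ + √m⁻¹ * C), fun k => ⟨?_, ?_⟩⟩
  · refine le_max_of_le_left ((norm_le_norm_add_norm_sub' (x k) xs).trans ?_)
    gcongr
    exact (hxF k).trans (by gcongr; exact hC k)
  · refine le_max_of_le_right ((norm_le_norm_add_norm_sub' (w k) ws).trans ?_)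
    gcongr
    exact (hwF k).trans (by gcongr; exact hC k)
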